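/- Let ω be a weight on ℝ₊ with ω ∈ B_p(∞), 1 < p < ∞, u ∈ D^{1,p}(ℝ₊,ω) and c ∈ ℝ. Then the following are equivalent: (a) there exists a sequence t_n ↑ ∞ with u(t_n) → c; (b) lim_{t→∞} u(t) = c; (c) lim_{t→∞} (u(t) − c)/Ω^∞_ω(t) = 0 and sup_{t>0} (u(t) − c)/Ω^∞_ω(t) < ∞; (d) u ∈ R^∞_{p,ω}(c). -/

import Mathlib

open MeasureTheory Set Filter Topology
open scoped NNReal ENNReal

noncomputable section

/-- A weight on `ℝ₊ = (0,∞)`: continuous and positive there. -/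
def IsWeight (ω : ℝ → ℝ) : Prop :=
  ContinuousOn ω (Set.Ioi 0) ∧ ∀ t : ℝ, 0 < t → 0 < ω t

/-- Membership of the pair `(u, u')` in the weighted Dirichlet space
`D^{1,p}(ℝ₊, ω)`: `u'` is locally integrable on `(0,∞)`, `u` is locally
absolutely continuous with derivative `u'`, and `∫_0^∞ |u'|^p ω < ∞`. -/
def MemD (p : ℝ) (ω u u' : ℝ → ℝ) : Prop :=
  (∀ a b : ℝ, 0 < a → a < b → IntegrableOn u' (Set.Ioc a b)) ∧
  (∀ a b : ℝ, 0 < a → a < b → u b - u a = ∫ τ in a..b, u' τ) ∧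
  IntegrableOn (fun t => |u' t| ^ p * ω t) (Set.Ioi 0)

/-- `‖u'‖_{L^p(ℝ₊, ω)} = (∫_0^∞ |u'(t)|^p ω(t) dt)^{1/p}`. -/
def dNorm (p : ℝ) (ω u' : ℝ → ℝ) : ℝ :=
  (∫ t in Set.Ioi (0:ℝ), |u' t| ^ p * ω t) ^ (1 / p)

/-- The norm `‖u‖^{(a)} = |u(a)| + ‖u'‖_{L^p(ℝ₊, ω)}`. -/
def aNorm (p : ℝ) (ω : ℝ → ℝ) (a : ℝ) (u u' : ℝ → ℝ) : ℝ :=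
  |u a| + dNorm p ω u'

/-- `ω ∈ B_p(0)`: `∫_0^1 ω(t)^{-1/(p-1)} dt < ∞`. -/
def Bp0 (p : ℝ) (ω : ℝ → ℝ) : Prop :=
  IntegrableOn (fun t => ω t ^ (-1 / (p - 1))) (Set.Ioc (0:ℝ) 1)

/-- `ω ∈ B_p(∞)`: `∫_1^∞ ω(t)^{-1/(p-1)} dt < ∞`. -/
def BpInf (p : ℝ) (ω : ℝ → ℝ) : Prop :=
  IntegrableOn (fun t => ω t ^ (-1 / (p - 1))) (Set.Ioi (1:ℝ))

/-- `Ω^0_ω(t) = (∫_0^t ω(τ)^{-1/(p-1)} dτ)^{1-1/p}`. -/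
def Omega0 (p : ℝ) (ω : ℝ → ℝ) (t : ℝ) : ℝ :=
  (∫ τ in Set.Ioc (0:ℝ) t, ω τ ^ (-1 / (p - 1))) ^ (1 - 1 / p)

/-- `Ω^∞_ω(t) = (∫_t^∞ ω(τ)^{-1/(p-1)} dτ)^{1-1/p}`. -/
def OmegaInf (p : ℝ) (ω : ℝ → ℝ) (t : ℝ) : ℝ :=
  (∫ τ in Set.Ioi t, ω τ ^ (-1 / (p - 1))) ^ (1 - 1 / p)

/-- `R^0_{p,ω}(c)`: elements of `D^{1,p}(ℝ₊,ω)` with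
`u(t) = c + ∫_0^t u'(τ) dτ` for every `t > 0`. -/
def MemR0 (p : ℝ) (ω : ℝ → ℝ) (c : ℝ) (u u' : ℝ → ℝ) : Prop :=
  MemD p ω u u' ∧ ∀ t : ℝ, 0 < t →
    IntegrableOn u' (Set.Ioc 0 t) ∧ u t = c + ∫ τ in Set.Ioc (0:ℝ) t, u' τ

/-- `R^∞_{p,ω}(c)`: elements of `D^{1,p}(ℝ₊,ω)` with
`u(t) = c - ∫_t^∞ u'(τ) dτ` for every `t > 0`. -/
def MemRInf (p : ℝ) (ω : ℝ → ℝ) (c : ℝ) (u u' : ℝ → ℝ) : Prop :=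
  MemD p ω u u' ∧ ∀ t : ℝ, 0 < t →
    IntegrableOn u' (Set.Ioi t) ∧ u t = c - ∫ τ in Set.Ioi t, u' τ

/-- `D_0^{1,p}(ℝ₊,ω)`: elements of `D^{1,p}(ℝ₊,ω)` approximable by smooth
compactly supported functions on `(0,∞)`, with derivatives converging in
`L^p(ℝ₊,ω)` and locally uniform convergence on compact subsets of `(0,∞)`. -/
def MemD0 (p : ℝ) (ω u u' : ℝ → ℝ) : Prop :=
  MemD p ω u u' ∧
  ∃ φ : ℕ → ℝ → ℝ,
    (∀ n, ContDiff ℝ (⊤ : ℕ∞) (φ n) ∧ HasCompactSupport (φ n) ∧ tsupport (φ n) ⊆ Set.Ioi 0) ∧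
    Tendsto (fun n => ∫ t in Set.Ioi (0:ℝ), |deriv (φ n) t - u' t| ^ p * ω t)
      atTop (𝓝 0) ∧
    (∀ K : Set ℝ, K ⊆ Set.Ioi 0 → IsCompact K →
      TendstoUniformlyOn (fun n => φ n) u atTop K)

theorem tendsto_setIntegral_Ioi_atTop_zero {f : ℝ → ℝ} {a : ℝ} (hf : IntegrableOn f (Set.Ioi a)) :
    Tendsto (fun t => ∫ x in Set.Ioi t, f x) atTop (𝓝 0) := by
  have h := (intervalIntegral_tendsto_integral_Ioi a hf tendsto_id).const_sub
    (∫ x in Set.Ioi a, f x)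
  rw [sub_self] at h
  refine h.congr' ?_
  filter_upwards [eventually_ge_atTop a] with t ht
  have := intervalIntegral.integral_Ioi_sub_Ioi hf ht
  simp only [id]
  linarith

theorem BpInf.integrableOn_Ioi {p : ℝ} {ω : ℝ → ℝ} (hB : BpInf p ω) (hω : IsWeight ω)
    {t : ℝ} (ht : 0 < t) : IntegrableOn (fun x => ω x ^ (-1 / (p - 1))) (Set.Ioi t) := by
  have hc : ContinuousOn (fun x => ω x ^ (-1 / (p - 1))) (Set.Icc t (max t 1)) := by
    have hs : Set.Icc t (max t 1) ⊆ Set.Ioi 0 := fun x hx => ht.trans_le hx.1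
    exact (hω.1.mono hs).rpow_const fun x hx => Or.inl (hω.2 x (hs hx)).ne'
  refine (hc.integrableOn_Icc.union hB).mono_set fun x hx => ?_
  rcases le_or_gt x (max t 1) with h | h
  · exact Or.inl ⟨le_of_lt hx, h⟩
  · exact Or.inr ((le_max_right t 1).trans_lt h)

theorem OmegaInf_pos {p : ℝ} {ω : ℝ → ℝ} (hω : IsWeight ω) (hB : BpInf p ω)
    {t : ℝ} (ht : 0 < t) : 0 < OmegaInf p ω t := by
  refine Real.rpow_pos_of_pos ?_ _
  have hpos : ∀ x ∈ Set.Ioi t, 0 < ω x ^ (-1 / (p - 1)) :=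
    fun x hx => Real.rpow_pos_of_pos (hω.2 x (ht.trans hx)) _
  rw [setIntegral_pos_iff_support_of_nonneg_ae
    ((ae_restrict_iff' measurableSet_Ioi).2 (ae_of_all _ fun x hx => (hpos x hx).le))
    (hB.integrableOn_Ioi hω ht)]
  rw [Set.inter_eq_self_of_subset_right (s := Function.support _)
    fun x hx => (hpos x hx).ne']
  simp

theorem tendsto_OmegaInf {p : ℝ} {ω : ℝ → ℝ} (hp : 1 < p) (hB : BpInf p ω) :
    Tendsto (OmegaInf p ω) atTop (𝓝 0) := by
  have he : 0 < 1 - 1 / p := by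
    rw [sub_pos, div_lt_one (by linarith)]; exact hp
  have := (tendsto_setIntegral_Ioi_atTop_zero hB).rpow_const (p := 1 - 1 / p) (Or.inr he.le)
  rwa [Real.zero_rpow he.ne'] at this

theorem MemD.aestronglyMeasurable {p : ℝ} {ω u u' : ℝ → ℝ} (hu : MemD p ω u u')
    {t : ℝ} (ht : 0 < t) : AEStronglyMeasurable u' (volume.restrict (Set.Ioi t)) := by
  have hU : Set.Ioi t = ⋃ n : ℕ, Set.Ioc t (t + (n + 1)) := by
    ext x
    simp only [Set.mem_iUnion, Set.mem_Ioc, Set.mem_Ioi, exists_and_left]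
    refine ⟨fun h => ⟨h, ?_⟩, fun h => h.1⟩
    obtain ⟨n, hn⟩ := exists_nat_ge (x - t)
    exact ⟨n, by linarith⟩
  rw [hU, aestronglyMeasurable_iUnion_iff]
  intro n
  exact (hu.1 t _ ht (by linarith [n.cast_nonneg (α := ℝ)])).aestronglyMeasurable

/-- Hölder's inequality for the derivative on a half-line, with weight `ω`. -/
theorem MemD.integrableOn_and_integral_abs_le {p : ℝ} {ω u u' : ℝ → ℝ} (hp : 1 < p)
    (hω : IsWeight ω) (hB : BpInf p ω) (hu : MemD p ω u u') {t : ℝ} (ht : 0 < t) :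
    IntegrableOn u' (Set.Ioi t) ∧ ∫ x in Set.Ioi t, |u' x| ≤
      (∫ x in Set.Ioi t, |u' x| ^ p * ω x) ^ (1 / p) * OmegaInf p ω t := by
  have hp0 : 0 < p := by linarith
  have hp1 : 0 < p - 1 := by linarith
  have hpq : p.HolderConjugate (p / (p - 1)) := Real.HolderConjugate.conjExponent hp
  have hωpos : ∀ x ∈ Set.Ioi t, 0 < ω x := fun x hx => hω.2 x (ht.trans hx)
  have hmeas := hu.aestronglyMeasurable ht
  have hωr : ∀ r : ℝ, AEStronglyMeasurable (fun x => ω x ^ r) (volume.restrict (Set.Ioi t)) :=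
    fun r => ((hω.1.mono (Set.Ioi_subset_Ioi ht.le)).rpow_const
      fun x hx => Or.inl (hωpos x hx).ne').aestronglyMeasurable measurableSet_Ioi
  have hfm : AEStronglyMeasurable (fun x => |u' x| * ω x ^ (1 / p))
      (volume.restrict (Set.Ioi t)) := hmeas.norm.mul (hωr _)
  have hf_pow : ∀ x ∈ Set.Ioi t, (|u' x| * ω x ^ (1 / p)) ^ p = |u' x| ^ p * ω x := by
    intro x hx
    have := hωpos x hx
    rw [Real.mul_rpow (abs_nonneg _) (by positivity), ← Real.rpow_mul this.le,
      one_div_mul_cancel hp0.ne', Real.rpow_one]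
  have hg_pow : ∀ x ∈ Set.Ioi t,
      (ω x ^ (-(1 / p))) ^ (p / (p - 1)) = ω x ^ (-1 / (p - 1)) := by
    intro x hx
    rw [← Real.rpow_mul (hωpos x hx).le]
    congr 1
    field_simp
  have hprod : ∀ x ∈ Set.Ioi t, (|u' x| * ω x ^ (1 / p)) * ω x ^ (-(1 / p)) = |u' x| := by
    intro x hx
    rw [mul_assoc, ← Real.rpow_add (hωpos x hx), add_neg_cancel, Real.rpow_zero, mul_one]
  have hfn : ∀ x ∈ Set.Ioi t, 0 ≤ |u' x| * ω x ^ (1 / p) := fun x hx =>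
    mul_nonneg (abs_nonneg _) (Real.rpow_nonneg (hωpos x hx).le _)
  have hgn : ∀ x ∈ Set.Ioi t, 0 ≤ ω x ^ (-(1 / p)) := fun x hx =>
    Real.rpow_nonneg (hωpos x hx).le _
  have hE : IntegrableOn (fun x => |u' x| ^ p * ω x) (Set.Ioi t) :=
    hu.2.2.mono_set (Set.Ioi_subset_Ioi ht.le)
  have hfL : MemLp (fun x => |u' x| * ω x ^ (1 / p)) (ENNReal.ofReal p)
      (volume.restrict (Set.Ioi t)) := by
    rw [← integrable_norm_rpow_iff hfm (by simpa using hp0) ENNReal.ofReal_ne_top,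
      ENNReal.toReal_ofReal hp0.le]
    refine hE.congr_fun (fun x hx => ?_) measurableSet_Ioi
    simp only [Real.norm_of_nonneg (hfn x hx), hf_pow x hx]
  have hgL : MemLp (fun x => ω x ^ (-(1 / p))) (ENNReal.ofReal (p / (p - 1)))
      (volume.restrict (Set.Ioi t)) := by
    have hq0 : 0 < p / (p - 1) := by positivity
    rw [← integrable_norm_rpow_iff (hωr _) (by simpa using hq0) ENNReal.ofReal_ne_top,
      ENNReal.toReal_ofReal hq0.le]
    refine (hB.integrableOn_Ioi hω ht).congr_fun (fun x hx => ?_) measurableSet_Ioi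
    simp only [Real.norm_of_nonneg (hgn x hx), hg_pow x hx]
  have : ENNReal.HolderConjugate (ENNReal.ofReal p) (ENNReal.ofReal (p / (p - 1))) :=
    hpq.ennrealOfReal
  constructor
  · have hint := hfL.integrable_mul hgL
    have habs : IntegrableOn (fun x => ‖u' x‖) (Set.Ioi t) :=
      IntegrableOn.congr_fun hint (fun x hx => hprod x hx) measurableSet_Ioi
    exact (integrable_norm_iff hmeas).1 habs
  · have hH := integral_mul_le_Lp_mul_Lq_of_nonneg hpq
      ((ae_restrict_iff' measurableSet_Ioi).2 (ae_of_all _ hfn))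
      ((ae_restrict_iff' measurableSet_Ioi).2 (ae_of_all _ hgn)) hfL hgL
    rw [setIntegral_congr_fun measurableSet_Ioi hprod,
      setIntegral_congr_fun measurableSet_Ioi hf_pow,
      setIntegral_congr_fun measurableSet_Ioi hg_pow] at hH
    have hexp : 1 / (p / (p - 1)) = 1 - 1 / p := by field_simp
    rwa [hexp] at hH

theorem memRInf_of_tendsto_seq {p : ℝ} {ω u u' : ℝ → ℝ} (hp : 1 < p)
    (hω : IsWeight ω) (hB : BpInf p ω) (hu : MemD p ω u u') {c : ℝ} {s : ℕ → ℝ}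
    (hs : Tendsto s atTop atTop) (hc : Tendsto (fun n => u (s n)) atTop (𝓝 c)) :
    MemRInf p ω c u u' := by
  refine ⟨hu, fun t ht => ?_⟩
  have hi := (hu.integrableOn_and_integral_abs_le hp hω hB ht).1
  refine ⟨hi, ?_⟩
  have h1 := intervalIntegral_tendsto_integral_Ioi t hi hs
  have h2 : Tendsto (fun n => ∫ x in t..s n, u' x) atTop (𝓝 (c - u t)) := by
    refine (hc.sub_const (u t)).congr' ?_
    filter_upwards [hs.eventually_gt_atTop t] with n hn
    exact hu.2.1 t _ ht hn
  have := tendsto_nhds_unique h1 h2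
  linarith

theorem MemRInf.abs_div_OmegaInf_le {p : ℝ} {ω u u' : ℝ → ℝ} (hp : 1 < p)
    (hω : IsWeight ω) (hB : BpInf p ω) {c : ℝ} (h : MemRInf p ω c u u') {t : ℝ} (ht : 0 < t) :
    |(u t - c) / OmegaInf p ω t| ≤ (∫ x in Set.Ioi t, |u' x| ^ p * ω x) ^ (1 / p) := by
  have hΩ := OmegaInf_pos hω hB ht
  rw [abs_div, abs_of_pos hΩ, div_le_iff₀ hΩ]
  refine le_trans ?_ (h.1.integrableOn_and_integral_abs_le hp hω hB ht).2
  rw [(h.2 t ht).2, sub_sub_cancel_left, abs_neg]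
  exact abs_integral_le_integral_abs

theorem MemRInf.tendsto_and_bounded {p : ℝ} {ω u u' : ℝ → ℝ} (hp : 1 < p)
    (hω : IsWeight ω) (hB : BpInf p ω) {c : ℝ} (h : MemRInf p ω c u u') :
    Tendsto (fun t => (u t - c) / OmegaInf p ω t) atTop (𝓝 0) ∧
      ∃ M : ℝ, ∀ t : ℝ, 0 < t → (u t - c) / OmegaInf p ω t ≤ M := by
  have hp' : 0 < 1 / p := by positivity
  constructor
  · have hE := (tendsto_setIntegral_Ioi_atTop_zero h.1.2.2).rpow_const (p := 1 / p)
      (Or.inr hp'.le)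
    rw [Real.zero_rpow hp'.ne'] at hE
    refine squeeze_zero_norm' ?_ hE
    filter_upwards [eventually_gt_atTop 0] with t ht
    exact h.abs_div_OmegaInf_le hp hω hB ht
  · refine ⟨(∫ x in Set.Ioi 0, |u' x| ^ p * ω x) ^ (1 / p), fun t ht => ?_⟩
    have hnn : ∀ x ∈ Set.Ioi (0 : ℝ), 0 ≤ |u' x| ^ p * ω x := fun x hx =>
      mul_nonneg (Real.rpow_nonneg (abs_nonneg _) _) (hω.2 x hx).le
    refine (le_abs_self _).trans ((h.abs_div_OmegaInf_le hp hω hB ht).trans ?_)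
    refine Real.rpow_le_rpow (setIntegral_nonneg measurableSet_Ioi
      fun x hx => hnn x (ht.trans hx)) ?_ hp'.le
    exact setIntegral_mono_set h.1.2.2
      ((ae_restrict_iff' measurableSet_Ioi).2 (ae_of_all _ hnn))
      (Set.Ioi_subset_Ioi ht.le).eventuallyLE

theorem tendsto_of_tendsto_div_OmegaInf {p : ℝ} {ω u : ℝ → ℝ} (hp : 1 < p)
    (hω : IsWeight ω) (hB : BpInf p ω) {c : ℝ}
    (h : Tendsto (fun t => (u t - c) / OmegaInf p ω t) atTop (𝓝 0)) :
    Tendsto u atTop (𝓝 c) := by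
  have h1 := (h.mul (tendsto_OmegaInf hp hB)).add_const c
  rw [mul_zero, zero_add] at h1
  refine h1.congr' ?_
  filter_upwards [eventually_gt_atTop 0] with t ht
  rw [div_mul_cancel₀ _ (OmegaInf_pos hω hB ht).ne', sub_add_cancel]

/-- for `ω ∈ B_p(∞)` and `u ∈ D^{1,p}(ℝ₊,ω)` the four conditions
(a) some sequence `t_n ↑ ∞` with `u(t_n) → c`;
(b) `lim_{t→∞} u(t) = c`;
(c) `(u(t)-c)/Ω^∞_ω(t) → 0` as `t → ∞` and `sup_{t>0}(u(t)-c)/Ω^∞_ω(t) < ∞`;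
(d) `u ∈ R^∞_{p,ω}(c)`
are equivalent. -/
theorem stmt6 (p : ℝ) (ω : ℝ → ℝ) (hp : 1 < p) (hω : IsWeight ω)
    (hB : BpInf p ω) (u u' : ℝ → ℝ) (hu : MemD p ω u u') (c : ℝ) :
    ((∃ t : ℕ → ℝ, (∀ n, 0 < t n) ∧ StrictMono t ∧ Tendsto t atTop atTop ∧
        Tendsto (fun n => u (t n)) atTop (𝓝 c)) ↔
      Tendsto u atTop (𝓝 c)) ∧
    (Tendsto u atTop (𝓝 c) ↔
      (Tendsto (fun t => (u t - c) / OmegaInf p ω t) atTop (𝓝 0) ∧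
        ∃ M : ℝ, ∀ t : ℝ, 0 < t → (u t - c) / OmegaInf p ω t ≤ M)) ∧
    ((Tendsto (fun t => (u t - c) / OmegaInf p ω t) atTop (𝓝 0) ∧
        ∃ M : ℝ, ∀ t : ℝ, 0 < t → (u t - c) / OmegaInf p ω t ≤ M) ↔
      MemRInf p ω c u u') := by
  have hmem : Tendsto u atTop (𝓝 c) → MemRInf p ω c u u' := fun h =>
    memRInf_of_tendsto_seq hp hω hB hu tendsto_natCast_atTop_atTop
      (h.comp tendsto_natCast_atTop_atTop)
  have hlim : MemRInf p ω c u u' → Tendsto u atTop (𝓝 c) := fun h =>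
    tendsto_of_tendsto_div_OmegaInf hp hω hB (h.tendsto_and_bounded hp hω hB).1
  refine ⟨⟨?_, fun h => ?_⟩, ⟨fun h => (hmem h).tendsto_and_bounded hp hω hB,
    fun h => tendsto_of_tendsto_div_OmegaInf hp hω hB h.1⟩,
    ⟨fun h => hmem (tendsto_of_tendsto_div_OmegaInf hp hω hB h.1),
    fun h => h.tendsto_and_bounded hp hω hB⟩⟩
  · rintro ⟨s, -, -, hs, hc⟩
    exact hlim (memRInf_of_tendsto_seq hp hω hB hu hs hc)
  · have hs : Tendsto (fun n : ℕ => (n : ℝ) + 1) atTop atTop :=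
      tendsto_atTop_add_const_right _ _ tendsto_natCast_atTop_atTop
    exact ⟨fun n => n + 1, fun n => by positivity,
      fun m n hmn => by simpa using hmn, hs, h.comp hs⟩

end
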